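/- (Perry's inversion of the Radon transform.) Let h : ℝ² → ℝ be a smooth function whose support is contained in the open unit disk 𝔻. Then for every integer n and every r with 0 < r < 1, h_n(r) = −(1/(π r)) [ ∫_r^1 (d/ds)(Rh)_n(s) · (s/r + √(s²/r² − 1))^{−|n|} / √(s²/r² − 1) ds − ∫_0^r (d/ds)(Rh)_n(s) · U_{|n|−1}(s/r) ds ], where U_k denotes the degree-k Chebyshev polynomial of the second kind evaluated as a polynomial at real arguments, with the convention U_{−1} = 0. -/

import Mathlib

open Real MeasureTheory Set

noncomputable section

/-- The unit vector at polar angle `θ`. -/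
def Phi (θ : ℝ) : ℝ × ℝ := (Real.cos θ, Real.sin θ)

/-- Rotation of a vector by 90° counterclockwise. -/
def perp (w : ℝ × ℝ) : ℝ × ℝ := (-w.2, w.1)

/-- Euclidean dot product on `ℝ × ℝ`. -/
def dot (a b : ℝ × ℝ) : ℝ := a.1 * b.1 + a.2 * b.2

/-- The open unit disk in the plane. -/
def unitDisk : Set (ℝ × ℝ) := {x | x.1 ^ 2 + x.2 ^ 2 < 1}

/-- The closed unit disk in the plane. -/
def closedUnitDisk : Set (ℝ × ℝ) := {x | x.1 ^ 2 + x.2 ^ 2 ≤ 1}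

/-- The unit circle in the plane. -/
def unitCircle : Set (ℝ × ℝ) := {x | x.1 ^ 2 + x.2 ^ 2 = 1}

/-- The Radon transform of a scalar function. -/
def radon (h : ℝ × ℝ → ℝ) (s θ : ℝ) : ℝ :=
  ∫ t : ℝ, h (s • Phi θ + t • Phi (θ + π / 2))

/-- The weighted V-line transform of a scalar function, with weights `c₁, c₂`. -/
def Vw (c₁ c₂ : ℝ) (h : ℝ × ℝ → ℝ) (φ ψ : ℝ) : ℝ :=
  c₁ * (∫ t in Ioi (0 : ℝ), h (Phi φ + t • Phi (π + φ - ψ))) +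
  c₂ * (∫ t in Ioi (0 : ℝ), h (Phi φ + t • Phi (π + φ + ψ)))

/-- The `n`-th (complex) Fourier coefficient of a function of the angular variable. -/
def fourierCoeff' (g : ℝ → ℝ) (n : ℤ) : ℂ :=
  (1 / (2 * (π : ℂ))) * ∫ φ in (0 : ℝ)..(2 * π), (g φ : ℂ) * Complex.exp (-Complex.I * n * φ)

/-- The kernel of the inversion formula: `-U_{m-1}` on `(-∞, 1]` and
`(x - √(x² - 1))^m / √(x² - 1)` on `(1, ∞)`. -/
def cormackKernel (m : ℕ) (x : ℝ) : ℝ :=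
  if x ≤ 1 then -(Polynomial.Chebyshev.U ℝ ((m : ℤ) - 1)).eval x
  else (x - √(x ^ 2 - 1)) ^ m / √(x ^ 2 - 1)

/-- A continuous primitive of `-m * cormackKernel m`. -/
def cormackPrimitive (m : ℕ) (x : ℝ) : ℝ :=
  if x ≤ 1 then (Polynomial.Chebyshev.T ℝ (m : ℤ)).eval x else (x - √(x ^ 2 - 1)) ^ m

lemma sqrt_sq_sub_one_pos {x : ℝ} (hx : 1 < x) : 0 < √(x ^ 2 - 1) :=
  Real.sqrt_pos.2 (by nlinarith)

lemma sqrt_sq_sub_one_lt {x : ℝ} (hx : 1 < x) : √(x ^ 2 - 1) < x :=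
  (Real.sqrt_lt' (by linarith)).2 (by linarith)

lemma sub_sqrt_mul_add_sqrt {x : ℝ} (hx : 1 < x) :
    (x - √(x ^ 2 - 1)) * (x + √(x ^ 2 - 1)) = 1 := by
  have := Real.sq_sqrt (show 0 ≤ x ^ 2 - 1 by nlinarith)
  linear_combination -this

lemma sub_sqrt_le_one {x : ℝ} (hx : 1 < x) : x - √(x ^ 2 - 1) ≤ 1 := by
  have h1 := sub_sqrt_mul_add_sqrt hx
  have h2 := sqrt_sq_sub_one_pos hx
  have h3 := sqrt_sq_sub_one_lt hx
  nlinarith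

lemma hasDerivAt_cormackPrimitive (m : ℕ) {x : ℝ} (hx : x ≠ 1) :
    HasDerivAt (cormackPrimitive m) (-(m * cormackKernel m x)) x := by
  rcases lt_or_gt_of_ne hx with hx | hx
  · have h : HasDerivAt (fun x => (Polynomial.Chebyshev.T ℝ (m : ℤ)).eval x)
        (-(m * cormackKernel m x)) x := by
      have h := (Polynomial.Chebyshev.T ℝ (m : ℤ)).hasDerivAt x
      rw [Polynomial.Chebyshev.T_derivative_eq_U] at h
      simpa [cormackKernel, hx.le] using h
    refine h.congr_of_eventuallyEq ?_
    filter_upwards [Iio_mem_nhds hx] with y hy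
    simp [cormackPrimitive, (mem_Iio.1 hy).le]
  · have hw := sqrt_sq_sub_one_pos hx
    have h : HasDerivAt (fun x => (x - √(x ^ 2 - 1)) ^ m) (-(m * cormackKernel m x)) x := by
      have h0 : HasDerivAt (fun x : ℝ => x ^ 2 - 1) (2 * x) x := by
        simpa using (hasDerivAt_pow 2 x).sub_const 1
      have h1 := ((hasDerivAt_id x).sub (h0.sqrt (by nlinarith))).pow m
      refine h1.congr_deriv ?_
      simp only [cormackKernel, not_le.2 hx, if_false, id, Pi.sub_apply]
      rcases m with _ | m
      · simp
      · simp only [Nat.add_sub_cancel]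
        field_simp
        ring
    refine h.congr_of_eventuallyEq ?_
    filter_upwards [Ioi_mem_nhds hx] with y hy
    simp [cormackPrimitive, not_le.2 (mem_Ioi.1 hy)]

lemma continuous_cormackPrimitive (m : ℕ) : Continuous (cormackPrimitive m) := by
  refine Continuous.if_le (by fun_prop) (by fun_prop) continuous_id continuous_const ?_
  rintro x rfl
  simp

lemma abs_cormackPrimitive_le_one (m : ℕ) {x : ℝ} (hx : 0 ≤ x) : |cormackPrimitive m x| ≤ 1 := by
  unfold cormackPrimitive
  split_ifs with h
  · exact Polynomial.Chebyshev.abs_eval_T_real_le_one _ (abs_le.2 ⟨by linarith, h⟩)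
  · have h := not_le.1 h
    have h3 : 0 ≤ x - √(x ^ 2 - 1) := (sub_pos.2 (sqrt_sq_sub_one_lt h)).le
    rw [abs_of_nonneg (by positivity)]
    exact pow_le_one₀ h3 (sub_sqrt_le_one h)

lemma cormackPrimitive_add_mul_cormackKernel (m : ℕ) (x : ℝ) :
    cormackPrimitive (m + 1) x + x * cormackKernel (m + 1) x = cormackKernel m x := by
  unfold cormackPrimitive cormackKernel
  split_ifs with h
  · have h := congrArg (Polynomial.eval x) (Polynomial.Chebyshev.T_eq_X_mul_U_sub_U ℝ ((m : ℤ) - 1))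
    rw [show (m : ℤ) - 1 + 2 = m + 1 by ring, show (m : ℤ) - 1 + 1 = m by ring] at h
    simp only [Polynomial.eval_sub, Polynomial.eval_mul, Polynomial.eval_X] at h
    push_cast
    rw [show (m : ℤ) + 1 - 1 = m by ring, h]
    ring
  · have h := not_le.1 h
    have hw := sqrt_sq_sub_one_pos h
    have h1 := sub_sqrt_mul_add_sqrt h
    field_simp
    linear_combination (x - √(x ^ 2 - 1)) ^ m * h1

lemma intervalIntegrable_cormackKernel (m : ℕ) {M : ℝ} (hM : 1 ≤ M) :
    IntervalIntegrable (cormackKernel m) volume 0 M := by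
  refine IntervalIntegrable.trans (b := 1) ?_ ?_
  · refine (Continuous.intervalIntegrable (u := fun x =>
      -(Polynomial.Chebyshev.U ℝ ((m : ℤ) - 1)).eval x) (by fun_prop) 0 1).congr ?_
    intro x hx
    rw [uIoc_of_le zero_le_one] at hx
    simp [cormackKernel, hx.2]
  · have h0 : IntegrableOn (fun x : ℝ => 1 / √(x ^ 2 - 1)) (Ioc 1 M) := by
      refine intervalIntegral.integrableOn_deriv_of_nonneg
        (g := fun x => Real.log (x + √(x ^ 2 - 1))) ?_ ?_ ?_
      · refine ContinuousOn.log (by fun_prop) ?_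
        intro x hx
        have := Real.sqrt_nonneg (x ^ 2 - 1)
        have := hx.1
        positivity
      · intro x hx
        have hw := sqrt_sq_sub_one_pos hx.1
        have h0 : HasDerivAt (fun x : ℝ => x ^ 2 - 1) (2 * x) x := by
          simpa using (hasDerivAt_pow 2 x).sub_const 1
        have hx1 := hx.1
        have hp : 0 < x + √(x ^ 2 - 1) := by linarith
        refine (((hasDerivAt_id x).add (h0.sqrt (by nlinarith))).log hp.ne').congr_deriv ?_
        simp only [id, Pi.add_apply]
        field_simp
        ring
      · intro x hx
        positivity
    rw [intervalIntegrable_iff_integrableOn_Ioc_of_le hM]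
    have h1 : IntegrableOn (fun x : ℝ => (x - √(x ^ 2 - 1)) ^ m / √(x ^ 2 - 1)) (Ioc 1 M) := by
      refine Integrable.mono h0 (Measurable.aestronglyMeasurable (by fun_prop)) ?_
      filter_upwards [ae_restrict_mem measurableSet_Ioc] with x hx
      have h3 : 0 ≤ x - √(x ^ 2 - 1) := (sub_pos.2 (sqrt_sq_sub_one_lt hx.1)).le
      rw [Real.norm_of_nonneg (by positivity), Real.norm_of_nonneg (by positivity)]
      gcongr
      exact pow_le_one₀ h3 (sub_sqrt_le_one hx.1)
    refine h1.congr_fun ?_ measurableSet_Ioc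
    intro x hx
    simp [cormackKernel, hx.1]

section ParametricIntegral

variable {E V : Type*} [NormedAddCommGroup E] [NormedSpace ℝ E] [ProperSpace E]
  [NormedAddCommGroup V] [NormedSpace ℝ V]

lemma hasFDerivAt_intervalIntegral_of_contDiff {φ : E × ℝ → V} (hφ : ContDiff ℝ 1 φ)
    (a b : ℝ) (x : E) :
    HasFDerivAt (fun x => ∫ t in a..b, φ (x, t))
      (∫ t in a..b, (fderiv ℝ φ (x, t)).comp (ContinuousLinearMap.inl ℝ E ℝ)) x := by
  have hc : Continuous fun p : E × ℝ => (fderiv ℝ φ p).comp (ContinuousLinearMap.inl ℝ E ℝ) :=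
    (hφ.continuous_fderiv one_ne_zero).clm_comp continuous_const
  obtain ⟨C, hC⟩ := ((isCompact_closedBall x 1).prod (isCompact_uIcc (a := a) (b := b))
    ).exists_bound_of_continuousOn hc.continuousOn
  refine intervalIntegral.hasFDerivAt_integral_of_dominated_of_fderiv_le (μ := volume)
    (F := fun x t => φ (x, t))
    (F' := fun x t => (fderiv ℝ φ (x, t)).comp (ContinuousLinearMap.inl ℝ E ℝ))
    (bound := fun _ => C) (Metric.ball_mem_nhds x one_pos) ?_ ?_ ?_ ?_ ?_ ?_
  · refine Filter.Eventually.of_forall fun y => ?_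
    exact (hφ.continuous.comp (by fun_prop : Continuous fun t : ℝ => (y, t))).aestronglyMeasurable
  · exact (hφ.continuous.comp (by fun_prop : Continuous fun t : ℝ => (x, t))).intervalIntegrable _ _
  · exact (hc.comp (by fun_prop : Continuous fun t : ℝ => (x, t))).aestronglyMeasurable
  · refine Filter.Eventually.of_forall fun t ht y hy => ?_
    exact hC (y, t) ⟨Metric.ball_subset_closedBall hy, uIoc_subset_uIcc ht⟩
  · simp
  · refine Filter.Eventually.of_forall fun t _ y _ => ?_
    have h1 : HasFDerivAt (fun y : E => (y, t)) (ContinuousLinearMap.inl ℝ E ℝ) y :=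
      hasFDerivAt_prodMk_left y t
    exact ((hφ.differentiable one_ne_zero (y, t)).hasFDerivAt).comp y h1

end ParametricIntegral

lemma contDiff_intervalIntegral {E : Type} [NormedAddCommGroup E] [NormedSpace ℝ E]
    [ProperSpace E] (a b : ℝ) (k : ℕ) : ∀ {V : Type} [NormedAddCommGroup V] [NormedSpace ℝ V]
    {φ : E × ℝ → V}, ContDiff ℝ (⊤ : ℕ∞) φ → ContDiff ℝ k (fun x => ∫ t in a..b, φ (x, t)) := by
  induction k with
  | zero =>
    intro V _ _ φ hφ
    refine contDiff_zero.2 ?_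
    exact continuous_iff_continuousAt.2 fun x =>
      (hasFDerivAt_intervalIntegral_of_contDiff (hφ.of_le (by simp)) a b x).continuousAt
  | succ k ih =>
    intro V _ _ φ hφ
    have h := fun x => hasFDerivAt_intervalIntegral_of_contDiff (hφ.of_le (by simp)) a b x
    push_cast
    refine contDiff_succ_iff_hasFDerivAt.2 ⟨_, ?_, h⟩
    exact ih (φ := fun p => (fderiv ℝ φ p).comp (ContinuousLinearMap.inl ℝ E ℝ))
      ((hφ.fderiv_right (by simp)).clm_comp contDiff_const)

/-- The integral of `F` over the vertical line with abscissa `s`. -/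
def xray (F : ℝ × ℝ → ℂ) (s : ℝ) : ℂ := ∫ t : ℝ, F (s, t)

/-- A smooth function on the plane that vanishes outside the closed unit disk. -/
structure SmoothOnDisk (F : ℝ × ℝ → ℂ) : Prop where
  contDiff : ContDiff ℝ (⊤ : ℕ∞) F
  eq_zero : ∀ x : ℝ × ℝ, 1 < x.1 ^ 2 + x.2 ^ 2 → F x = 0

namespace SmoothOnDisk

variable {F : ℝ × ℝ → ℂ}

lemma xray_eq (hF : SmoothOnDisk F) (s : ℝ) : xray F s = ∫ t in (-2 : ℝ)..2, F (s, t) := by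
  rw [intervalIntegral.integral_of_le (by norm_num), xray]
  refine (setIntegral_eq_integral_of_forall_compl_eq_zero fun t ht => hF.eq_zero _ ?_).symm
  have : t ≤ -2 ∨ 2 < t := by
    by_contra! h
    exact ht ⟨h.1, h.2⟩
  rcases this with h | h <;> simp only <;> nlinarith [sq_nonneg s]

lemma xray_eq_zero (hF : SmoothOnDisk F) {s : ℝ} (hs : 1 < s) : xray F s = 0 := by
  have : ∀ t, F (s, t) = 0 := fun t => hF.eq_zero _ (by simp only; nlinarith [sq_nonneg t])
  simp [xray, this]

lemma fderiv_apply (hF : SmoothOnDisk F) (v : ℝ × ℝ) :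
    SmoothOnDisk fun x => fderiv ℝ F x v where
  contDiff := (hF.contDiff.fderiv_right (by simp)).clm_apply contDiff_const
  eq_zero x hx := by
    have : F =ᶠ[nhds x] fun _ => 0 := by
      have ho : IsOpen {y : ℝ × ℝ | 1 < y.1 ^ 2 + y.2 ^ 2} :=
        isOpen_lt continuous_const (by fun_prop)
      filter_upwards [ho.mem_nhds hx] with y hy using hF.eq_zero y hy
    rw [this.fderiv_eq]
    simp

lemma hasFDerivAt (hF : SmoothOnDisk F) (x : ℝ × ℝ) : HasFDerivAt F (fderiv ℝ F x) x :=
  (hF.contDiff.differentiable (by simp) x).hasFDerivAt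

lemma hasDerivAt_xray (hF : SmoothOnDisk F) (s : ℝ) :
    HasDerivAt (xray F) (xray (fun x => fderiv ℝ F x (1, 0)) s) s := by
  have h := (hasFDerivAt_intervalIntegral_of_contDiff (hF.contDiff.of_le (by simp))
    (-2) 2 s).hasDerivAt
  rw [funext hF.xray_eq, (hF.fderiv_apply (1, 0)).xray_eq]
  refine h.congr_deriv ?_
  rw [ContinuousLinearMap.intervalIntegral_apply]
  · simp
  · refine Continuous.intervalIntegrable ?_ _ _
    exact ((hF.contDiff.continuous_fderiv (by simp)).comp (by fun_prop)).clm_comp continuous_const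

lemma xray_fderiv_snd (hF : SmoothOnDisk F) (s : ℝ) :
    xray (fun x => fderiv ℝ F x (0, 1)) s = 0 := by
  rw [(hF.fderiv_apply (0, 1)).xray_eq,
    intervalIntegral.integral_eq_sub_of_hasDerivAt (f := fun t => F (s, t))]
  · rw [hF.eq_zero (s, 2) (by nlinarith [sq_nonneg s]),
      hF.eq_zero (s, -2) (by nlinarith [sq_nonneg s]), sub_zero]
  · intro t _
    exact (hF.hasFDerivAt (s, t)).comp_hasDerivAt t ((hasDerivAt_const t s).prodMk (hasDerivAt_id t))
  · exact ((hF.fderiv_apply (0, 1)).contDiff.continuous.comp (by fun_prop)).intervalIntegrable _ _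

lemma integrable_xray (hF : SmoothOnDisk F) (s : ℝ) : Integrable fun t => F (s, t) := by
  refine (hF.contDiff.continuous.comp (by fun_prop)).integrable_of_hasCompactSupport ?_
  refine HasCompactSupport.intro (isCompact_Icc (a := (-2 : ℝ)) (b := 2)) fun t ht => ?_
  refine hF.eq_zero _ ?_
  have : t < -2 ∨ 2 < t := by
    by_contra! h
    exact ht ⟨h.1, h.2⟩
  rcases this with h | h <;> simp only <;> nlinarith [sq_nonneg s]

end SmoothOnDisk

/-- The differential operator `∂₁ - i ∂₂`. -/
def lowering (F : ℝ × ℝ → ℂ) (x : ℝ × ℝ) : ℂ :=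
  fderiv ℝ F x (1, 0) - Complex.I * fderiv ℝ F x (0, 1)

lemma SmoothOnDisk.lowering {F : ℝ × ℝ → ℂ} (hF : SmoothOnDisk F) :
    SmoothOnDisk (lowering F) where
  contDiff := (hF.fderiv_apply (1, 0)).contDiff.sub
    (contDiff_const.mul (hF.fderiv_apply (0, 1)).contDiff)
  eq_zero x hx := by
    simp [_root_.lowering, (hF.fderiv_apply (1, 0)).eq_zero x hx,
      (hF.fderiv_apply (0, 1)).eq_zero x hx]

lemma SmoothOnDisk.hasDerivAt_xray_lowering {F : ℝ × ℝ → ℂ} (hF : SmoothOnDisk F) (s : ℝ) :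
    HasDerivAt (xray F) (xray (_root_.lowering F) s) s := by
  refine (hF.hasDerivAt_xray s).congr_deriv ?_
  have h := hF.xray_fderiv_snd s
  simp only [xray, _root_.lowering] at h ⊢
  rw [integral_sub ((hF.fderiv_apply (1, 0)).integrable_xray s)
    (((hF.fderiv_apply (0, 1)).integrable_xray s).const_mul _), integral_const_mul, h]
  simp

/-- Rotation of the plane by the angle `α`. -/
def rotate (α : ℝ) : ℝ × ℝ →L[ℝ] ℝ × ℝ :=
  (Real.cos α • ContinuousLinearMap.fst ℝ ℝ ℝ - Real.sin α • ContinuousLinearMap.snd ℝ ℝ ℝ).prod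
    (Real.sin α • ContinuousLinearMap.fst ℝ ℝ ℝ + Real.cos α • ContinuousLinearMap.snd ℝ ℝ ℝ)

lemma rotate_apply (α : ℝ) (x : ℝ × ℝ) :
    rotate α x = (Real.cos α * x.1 - Real.sin α * x.2, Real.sin α * x.1 + Real.cos α * x.2) := by
  simp [rotate]

/-- A smooth function on the disk whose only angular frequency is `n`. -/
structure IsAngular (n : ℤ) (F : ℝ × ℝ → ℂ) : Prop extends SmoothOnDisk F where
  apply_rotate : ∀ α x, F (rotate α x) = Complex.exp (Complex.I * n * α) * F x

namespace IsAngular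

variable {n : ℤ} {F : ℝ × ℝ → ℂ}

lemma fderiv_rotate (hF : IsAngular n F) (α : ℝ) (x v : ℝ × ℝ) :
    fderiv ℝ F (rotate α x) (rotate α v) =
      Complex.exp (Complex.I * n * α) * fderiv ℝ F x v := by
  have h1 := (hF.hasFDerivAt (rotate α x)).comp x (rotate α).hasFDerivAt
  have h2 := (hF.hasFDerivAt x).const_mul (Complex.exp (Complex.I * n * α))
  rw [show F ∘ rotate α = fun x => Complex.exp (Complex.I * n * α) * F x from
    funext (hF.apply_rotate α)] at h1
  simpa using congrArg (fun L => L v) (h1.unique h2)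

protected lemma lowering (hF : IsAngular n F) : IsAngular (n - 1) (lowering F) where
  toSmoothOnDisk := hF.toSmoothOnDisk.lowering
  apply_rotate α x := by
    have h1 := hF.fderiv_rotate α x (1, 0)
    have h2 := hF.fderiv_rotate α x (0, 1)
    have e : ∀ a b : ℝ, fderiv ℝ F (rotate α x) (a, b) =
        a * fderiv ℝ F (rotate α x) (1, 0) + b * fderiv ℝ F (rotate α x) (0, 1) := by
      intro a b
      rw [show ((a, b) : ℝ × ℝ) = a • (1, 0) + b • (0, 1) by simp, map_add, map_smul, map_smul]
      simp
    rw [rotate_apply α (1, 0), e] at h1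
    rw [rotate_apply α (0, 1), e] at h2
    have h3 : Complex.exp (Complex.I * n * α) =
        (Complex.cos α + Complex.sin α * Complex.I) * Complex.exp (Complex.I * ↑(n - 1) * α) := by
      rw [← Complex.exp_mul_I, ← Complex.exp_add]
      congr 1
      push_cast
      ring
    have h4 : (Complex.cos α + Complex.sin α * Complex.I) *
        (Complex.cos α - Complex.sin α * Complex.I) = 1 := by
      linear_combination Complex.cos_sq_add_sin_sq (α : ℂ) - Complex.sin α ^ 2 * Complex.I_sq
    rw [h3] at h1 h2
    push_cast at h1 h2 ⊢
    simp only [mul_zero, mul_one, sub_zero, add_zero, zero_sub, zero_add] at h1 h2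
    refine mul_left_cancel₀ (left_ne_zero_of_mul (h4.trans_ne one_ne_zero)) ?_
    unfold _root_.lowering
    linear_combination h1 - Complex.I * h2 -
      Complex.sin α * fderiv ℝ F (rotate α x) (0, 1) * Complex.I_sq

lemma fderiv_tangent (hF : IsAngular n F) (x : ℝ × ℝ) :
    fderiv ℝ F x (-x.2, x.1) = Complex.I * n * F x := by
  have h0 : HasDerivAt (fun α => rotate α x) (-x.2, x.1) 0 := by
    have hc := Real.hasDerivAt_cos 0
    have hs := Real.hasDerivAt_sin 0
    have := ((hc.mul_const x.1).sub (hs.mul_const x.2)).prodMk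
      ((hs.mul_const x.1).add (hc.mul_const x.2))
    simp only [Real.sin_zero, Real.cos_zero] at this
    refine (this.congr_deriv ?_).congr_of_eventuallyEq ?_
    · simp
    · exact Filter.Eventually.of_forall fun α => by simp [rotate_apply]
  have hx : rotate 0 x = x := by simp [rotate_apply]
  have h1 := (show HasFDerivAt F (fderiv ℝ F x) (rotate 0 x) by
    rw [hx]; exact hF.hasFDerivAt x).comp_hasDerivAt 0 h0
  have h2 : HasDerivAt (fun α : ℝ => Complex.exp (Complex.I * n * α) * F x)
      (Complex.I * n * F x) 0 := by
    have := ((Complex.ofRealCLM.hasDerivAt (x := 0)).const_mul (Complex.I * n)).cexp.mul_const (F x)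
    simpa using this
  rw [show F ∘ (fun α => rotate α x) = fun α : ℝ => Complex.exp (Complex.I * n * α) * F x from
    funext fun α => hF.apply_rotate α x] at h1
  exact h1.unique h2

lemma hasDerivAt_axis (hF : IsAngular n F) (ρ : ℝ) :
    HasDerivAt (fun ρ : ℝ => F (ρ, 0)) (fderiv ℝ F (ρ, 0) (1, 0)) ρ :=
  (hF.hasFDerivAt (ρ, 0)).comp_hasDerivAt ρ ((hasDerivAt_id ρ).prodMk (hasDerivAt_const ρ (0 : ℝ)))

lemma mul_lowering_axis (hF : IsAngular n F) (ρ : ℝ) :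
    ρ * lowering F (ρ, 0) = ρ * fderiv ℝ F (ρ, 0) (1, 0) + n * F (ρ, 0) := by
  have h := hF.fderiv_tangent (ρ, 0)
  rw [show ((-(ρ, (0 : ℝ)).2, (ρ, (0 : ℝ)).1) : ℝ × ℝ) = ρ • (0, 1) by simp, map_smul,
    Complex.real_smul] at h
  unfold lowering
  linear_combination -Complex.I * h - n * F (ρ, 0) * Complex.I_sq

lemma xray_neg (hF : IsAngular n F) (s : ℝ) :
    xray F (-s) = Complex.exp (Complex.I * n * π) * xray F s := by
  have h : ∀ t : ℝ, F (-s, -t) = Complex.exp (Complex.I * n * π) * F (s, t) := by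
    intro t
    rw [← hF.apply_rotate π (s, t), rotate_apply]
    simp
  rw [xray, ← integral_neg_eq_self]
  simp only [h, integral_const_mul, xray]

end IsAngular

/-- The integral `∫ cormackKernel m x * g (r x) dx` over the positive half-line. -/
def kernelTransform (m : ℕ) (g : ℝ → ℂ) (r : ℝ) : ℂ :=
  ∫ x in Ioi (0 : ℝ), (cormackKernel m x : ℂ) * g (r * x)

lemma kernelTransform_zero (g : ℝ → ℂ) (r : ℝ) :
    kernelTransform 0 g r =
      ∫ v in Ioi (0 : ℝ), ((1 / √(1 + v ^ 2) : ℝ) : ℂ) * g (r * √(1 + v ^ 2)) := by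
  have h1 : kernelTransform 0 g r =
      ∫ x in Ioi (1 : ℝ), ((1 / √(x ^ 2 - 1) : ℝ) : ℂ) * g (r * x) := by
    rw [kernelTransform, setIntegral_eq_of_subset_of_forall_sdiff_eq_zero (s := Ioi (1 : ℝ))
      measurableSet_Ioi (Ioi_subset_Ioi zero_le_one)]
    · refine setIntegral_congr_fun measurableSet_Ioi fun x hx => ?_
      simp [cormackKernel, not_le.2 (mem_Ioi.1 hx)]
    · intro x hx
      simp [cormackKernel, not_lt.1 (show ¬ 1 < x from hx.2)]
  have himage : (fun v : ℝ => √(1 + v ^ 2)) '' Ioi 0 = Ioi 1 := by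
    ext x
    constructor
    · rintro ⟨v, hv, rfl⟩
      exact (Real.lt_sqrt zero_le_one).2 (by nlinarith [mem_Ioi.1 hv])
    · intro hx
      have hx := mem_Ioi.1 hx
      refine ⟨√(x ^ 2 - 1), sqrt_sq_sub_one_pos hx, ?_⟩
      simp only
      rw [Real.sq_sqrt (by nlinarith), show 1 + (x ^ 2 - 1) = x ^ 2 by ring,
        Real.sqrt_sq (by linarith)]
  have hder : ∀ v ∈ Ioi (0 : ℝ), HasDerivWithinAt (fun v : ℝ => √(1 + v ^ 2))
      (v / √(1 + v ^ 2)) (Ioi 0) v := by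
    intro v _
    have h0 : HasDerivAt (fun v : ℝ => 1 + v ^ 2) (2 * v) v := by
      simpa using (hasDerivAt_pow 2 v).const_add 1
    refine ((h0.sqrt (by positivity)).congr_deriv ?_).hasDerivWithinAt
    field_simp
  have hinj : InjOn (fun v : ℝ => √(1 + v ^ 2)) (Ioi 0) := by
    intro a ha b hb hab
    have h := (Real.sqrt_inj (by positivity) (by positivity)).1 hab
    exact (sq_eq_sq₀ (le_of_lt ha) (le_of_lt hb)).1 (by linarith)
  rw [h1, ← himage, integral_image_eq_integral_abs_deriv_smul measurableSet_Ioi hder hinj]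
  refine setIntegral_congr_fun measurableSet_Ioi fun v hv => ?_
  have hv := mem_Ioi.1 hv
  have hw : 0 < √(1 + v ^ 2) := Real.sqrt_pos.2 (by positivity)
  rw [Real.sq_sqrt (by positivity), show 1 + v ^ 2 - 1 = v ^ 2 by ring, Real.sqrt_sq hv.le,
    abs_of_pos (by positivity), Complex.real_smul, ← mul_assoc, ← Complex.ofReal_mul]
  congr 2
  field_simp

lemma IsAngular.fderiv_fst_of_zero {F : ℝ × ℝ → ℂ} (hF : IsAngular 0 F) {s t ρ : ℝ} (hρ : 0 < ρ)
    (h : ρ ^ 2 = s ^ 2 + t ^ 2) :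
    fderiv ℝ F (s, t) (1, 0) = (s / ρ : ℝ) * fderiv ℝ F (ρ, 0) (1, 0) := by
  obtain ⟨α, hs, ht⟩ : ∃ α, s = ρ * Real.cos α ∧ t = ρ * Real.sin α := by
    have hz : ‖(⟨s, t⟩ : ℂ)‖ = ρ := by
      rw [Complex.norm_eq_sqrt_sq_add_sq, ← h, Real.sqrt_sq hρ.le]
    exact ⟨Complex.arg ⟨s, t⟩, by rw [← hz, Complex.norm_mul_cos_arg],
      by rw [← hz, Complex.norm_mul_sin_arg]⟩
  have hx : rotate α (ρ, 0) = (s, t) := by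
    simp [rotate_apply, hs, ht, mul_comm]
  have h1 := hF.fderiv_rotate α (ρ, 0) (Real.cos α • (1, 0))
  have h2 := hF.fderiv_tangent (s, t)
  have e : ((1, 0) : ℝ × ℝ) =
      rotate α (Real.cos α • (1, 0)) - (Real.sin α / ρ) • (-(s, t).2, (s, t).1) := by
    have := Real.cos_sq_add_sin_sq α
    simp only [rotate_apply, hs, ht]
    ext
    · simp
      field_simp
      linarith
    · simp
      field_simp
      ring
  conv_lhs => rw [e, map_sub, map_smul _ (Real.sin α / ρ), h2, ← hx, h1, map_smul]
  rw [hs]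
  simp [hρ.ne']

lemma IsAngular.eq_kernelTransform_zero {F : ℝ × ℝ → ℂ} (hF : IsAngular 0 F) {r : ℝ}
    (hr : 0 < r) : F (r, 0) = -(1 / π) * kernelTransform 0 (xray (lowering F)) r := by
  set Ψ : ℝ → ℂ := fun w => ((r / √(1 + w) : ℝ) : ℂ) * fderiv ℝ F (r * √(1 + w), 0) (1, 0) with hΨ
  have hcont : Continuous fun x => fderiv ℝ F x (1, 0) := (hF.fderiv_apply (1, 0)).contDiff.continuous
  have hΨcont : ContinuousOn Ψ (Ici 0) := by
    refine ContinuousOn.mul ?_ ?_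
    · refine Complex.continuous_ofReal.comp_continuousOn ?_
      refine continuousOn_const.div (by fun_prop) fun w hw => ?_
      have := mem_Ici.1 hw
      positivity
    · exact (hcont.comp (by fun_prop : Continuous fun w : ℝ => (r * √(1 + w), (0 : ℝ)))).continuousOn
  have hΨzero : ∀ w, 0 ≤ w → 1 < r ^ 2 * w → Ψ w = 0 := by
    intro w hw h
    have := (hF.fderiv_apply (1, 0)).eq_zero (r * √(1 + w), 0) (by
      simp only
      rw [mul_pow, Real.sq_sqrt (by positivity)]
      nlinarith)
    simp [hΨ, this]
  have hxray : ∀ s, xray (lowering F) s = xray (fun x => fderiv ℝ F x (1, 0)) s := fun s =>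
    (hF.hasDerivAt_xray_lowering s).unique (hF.hasDerivAt_xray s)
  have hslice : ∀ v : ℝ, ((1 / √(1 + v ^ 2) : ℝ) : ℂ) * xray (lowering F) (r * √(1 + v ^ 2)) =
      ∫ τ : ℝ, Ψ (v ^ 2 + τ ^ 2) := by
    intro v
    have hw : 0 < √(1 + v ^ 2) := Real.sqrt_pos.2 (by positivity)
    have h := Measure.integral_comp_mul_left
      (fun t : ℝ => fderiv ℝ F (r * √(1 + v ^ 2), t) (1, 0)) r
    rw [abs_of_pos (inv_pos.2 hr), Complex.real_smul] at h
    have h' : xray (lowering F) (r * √(1 + v ^ 2)) =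
        r * ∫ τ : ℝ, fderiv ℝ F (r * √(1 + v ^ 2), r * τ) (1, 0) := by
      rw [h, ← mul_assoc, hxray, xray, ← Complex.ofReal_mul, mul_inv_cancel₀ hr.ne']
      simp
    rw [h', ← integral_const_mul, ← integral_const_mul]
    congr 1 with τ
    have hw' : 0 < √(1 + (v ^ 2 + τ ^ 2)) := Real.sqrt_pos.2 (by positivity)
    rw [hF.fderiv_fst_of_zero (ρ := r * √(1 + (v ^ 2 + τ ^ 2))) (by positivity) (by
      rw [mul_pow, mul_pow, Real.sq_sqrt (by positivity), Real.sq_sqrt (by positivity)]; ring)]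
    simp only [hΨ, ← mul_assoc, ← Complex.ofReal_mul]
    congr 2
    field_simp
  have hprod : Integrable (fun p : ℝ × ℝ => Ψ (p.1 ^ 2 + p.2 ^ 2)) := by
    refine Continuous.integrable_of_hasCompactSupport ?_ ?_
    · exact hΨcont.comp_continuous (by fun_prop) fun p => by simp only [mem_Ici]; positivity
    · refine HasCompactSupport.intro (isCompact_closedBall (0 : ℝ × ℝ) (1 / r)) fun p hp => ?_
      refine hΨzero _ (by positivity) ?_
      rw [mem_closedBall_zero_iff, not_le, Prod.norm_def, lt_max_iff, div_lt_iff₀ hr,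
        div_lt_iff₀ hr, Real.norm_eq_abs, Real.norm_eq_abs] at hp
      rcases hp with hp | hp
      · have : 1 < (|p.1| * r) ^ 2 := by nlinarith
        rw [mul_pow, sq_abs] at this
        nlinarith [sq_nonneg (r * p.2)]
      · have : 1 < (|p.2| * r) ^ 2 := by nlinarith
        rw [mul_pow, sq_abs] at this
        nlinarith [sq_nonneg (r * p.1)]
  have hhalf : kernelTransform 0 (xray (lowering F)) r =
      (1 / 2) * ∫ v : ℝ, ∫ τ : ℝ, Ψ (v ^ 2 + τ ^ 2) := by
    have hi : Integrable (fun v : ℝ => ∫ τ : ℝ, Ψ (v ^ 2 + τ ^ 2)) := hprod.integral_prod_left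
    have h := integral_comp_neg_Ioi 0 (fun v : ℝ => ∫ τ : ℝ, Ψ (v ^ 2 + τ ^ 2))
    simp only [neg_sq, neg_zero] at h
    rw [← intervalIntegral.integral_Iic_add_Ioi (b := 0) hi.integrableOn hi.integrableOn, ← h,
      kernelTransform_zero]
    simp only [hslice]
    ring
  have hradial : ∫ σ in Ioi (0 : ℝ), (σ : ℂ) * Ψ (σ ^ 2) = -F (r, 0) := by
    have hd : ∀ σ ∈ Ici (0 : ℝ), HasDerivAt (fun σ : ℝ => F (r * √(1 + σ ^ 2), 0))
        ((σ : ℂ) * Ψ (σ ^ 2)) σ := by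
      intro σ _
      have hw : 0 < √(1 + σ ^ 2) := Real.sqrt_pos.2 (by positivity)
      have h0 : HasDerivAt (fun v : ℝ => 1 + v ^ 2) (2 * σ) σ := by
        simpa using (hasDerivAt_pow 2 σ).const_add 1
      have h1 := (hF.hasDerivAt_axis (r * √(1 + σ ^ 2))).scomp σ
        ((h0.sqrt (by positivity)).const_mul r)
      refine h1.congr_deriv ?_
      rw [Complex.real_smul, hΨ]
      simp only [← mul_assoc, ← Complex.ofReal_mul]
      congr 2
      field_simp
    have hi : IntegrableOn (fun σ : ℝ => (σ : ℂ) * Ψ (σ ^ 2)) (Ioi 0) := by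
      refine (Continuous.integrable_of_hasCompactSupport ?_ ?_).integrableOn
      · exact Complex.continuous_ofReal.mul (hΨcont.comp_continuous (by fun_prop) fun p => by
          simp only [mem_Ici]; positivity)
      · refine HasCompactSupport.intro (isCompact_closedBall (0 : ℝ) (1 / r)) fun p hp => ?_
        rw [mem_closedBall_zero_iff, not_le, div_lt_iff₀ hr, Real.norm_eq_abs] at hp
        have : 1 < (|p| * r) ^ 2 := by nlinarith
        rw [mul_pow, sq_abs] at this
        rw [hΨzero _ (by positivity) (by linarith), mul_zero]
    have ht : Filter.Tendsto (fun σ : ℝ => F (r * √(1 + σ ^ 2), 0)) Filter.atTop (nhds 0) := by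
      refine tendsto_const_nhds.congr' ?_
      filter_upwards [Filter.eventually_gt_atTop (1 / r)] with σ hσ
      rw [div_lt_iff₀ hr] at hσ
      refine (hF.eq_zero _ ?_).symm
      simp only
      rw [mul_pow, Real.sq_sqrt (by positivity)]
      nlinarith
    rw [integral_Ioi_of_hasDerivAt_of_tendsto' hd hi ht]
    simp
  have hpolar : ∫ v : ℝ, ∫ τ : ℝ, Ψ (v ^ 2 + τ ^ 2) = -(2 * π) * F (r, 0) := by
    rw [← integral_prod (fun p : ℝ × ℝ => Ψ (p.1 ^ 2 + p.2 ^ 2)) hprod, ← Measure.volume_eq_prod,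
      ← integral_comp_polarCoord_symm]
    have e : ∀ p : ℝ × ℝ, (polarCoord.symm p).1 ^ 2 + (polarCoord.symm p).2 ^ 2 = p.1 ^ 2 := by
      intro p
      rw [polarCoord_symm_apply]
      linear_combination p.1 ^ 2 * Real.cos_sq_add_sin_sq p.2
    simp only [e, polarCoord_target]
    have h := setIntegral_prod_mul (μ := (volume : Measure ℝ)) (ν := (volume : Measure ℝ))
      (fun σ : ℝ => (σ : ℂ) * Ψ (σ ^ 2)) (fun _ : ℝ => (1 : ℂ)) (Ioi 0) (Ioo (-π) π)
    rw [← Measure.volume_eq_prod, hradial] at h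
    simp only [mul_one] at h
    simp only [Complex.real_smul]
    rw [h]
    simp [Real.pi_pos.le, ← two_mul]
    ring
  rw [hhalf, hpolar]
  have := Complex.ofReal_ne_zero.2 Real.pi_ne_zero
  field_simp

section KernelTransform

variable {g g' : ℝ → ℂ}

lemma kernelTransform_eq_intervalIntegral (m : ℕ) (hg0 : ∀ s, 1 < s → g s = 0) {r M : ℝ}
    (hr : 0 < r) (hM : 0 ≤ M) (hrM : 1 ≤ r * M) :
    kernelTransform m g r = ∫ x in (0 : ℝ)..M, (cormackKernel m x : ℂ) * g (r * x) := by
  rw [intervalIntegral.integral_of_le hM, kernelTransform,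
    setIntegral_eq_of_subset_of_forall_sdiff_eq_zero measurableSet_Ioi Ioc_subset_Ioi_self]
  intro x hx
  have : M < x := by
    by_contra! h
    exact hx.2 ⟨hx.1, h⟩
  rw [hg0 _ (by nlinarith), mul_zero]

lemma intervalIntegrable_cormackKernel_mul (m : ℕ) {M : ℝ} (hM : 1 ≤ M) {f : ℝ → ℂ}
    (hf : Continuous f) :
    IntervalIntegrable (fun x => (cormackKernel m x : ℂ) * f x) volume 0 M :=
  IntervalIntegrable.mul_continuousOn ⟨(intervalIntegrable_cormackKernel m hM).1.ofReal,
    (intervalIntegrable_cormackKernel m hM).2.ofReal⟩ hf.continuousOn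

lemma hasDerivAt_kernelTransform (m : ℕ) (hg : ∀ s, HasDerivAt g (g' s) s)
    (hg' : Continuous g') (hg0 : ∀ s, 1 < s → g s = 0) {C : ℝ}
    (hC : ∀ s, 0 ≤ s → ‖g' s‖ ≤ C) {r M : ℝ} (hr : 0 < r) (hM : 1 ≤ M) (hrM : 1 < r * M) :
    HasDerivAt (kernelTransform m g)
      (∫ x in (0 : ℝ)..M, (cormackKernel m x : ℂ) * (x * g' (r * x))) r := by
  have hgc : Continuous g := continuous_iff_continuousAt.2 fun s => (hg s).continuousAt
  have h := (intervalIntegral.hasDerivAt_integral_of_dominated_loc_of_deriv_le (μ := volume)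
    (F := fun r x => (cormackKernel m x : ℂ) * g (r * x))
    (F' := fun r x => (cormackKernel m x : ℂ) * (x * g' (r * x))) (x₀ := r) (a := 0) (b := M)
    (bound := fun x => |cormackKernel m x| * (M * C)) (Ioi_mem_nhds hr) ?_ ?_ ?_ ?_ ?_ ?_).2
  · refine h.congr_of_eventuallyEq ?_
    have hlim : ∀ᶠ r' in nhds r, 1 < r' * M :=
      (by fun_prop : ContinuousAt (fun r' => r' * M) r).eventually (lt_mem_nhds hrM)
    filter_upwards [Ioi_mem_nhds hr, hlim] with r' hr' hrM'
    exact kernelTransform_eq_intervalIntegral m hg0 hr' (by linarith) hrM'.le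
  · exact Filter.Eventually.of_forall fun r' =>
      (intervalIntegrable_cormackKernel_mul m hM (f := fun x => g (r' * x))
        (by fun_prop)).def'.aestronglyMeasurable
  · exact intervalIntegrable_cormackKernel_mul m hM (by fun_prop)
  · exact (intervalIntegrable_cormackKernel_mul m hM (f := fun x => x * g' (r * x))
      (by fun_prop)).def'.aestronglyMeasurable
  · refine Filter.Eventually.of_forall fun x hx r' hr' => ?_
    rw [uIoc_of_le (by linarith)] at hx
    have hr' := mem_Ioi.1 hr'
    have hx0 := hx.1
    rw [norm_mul, norm_mul, Complex.norm_real, Complex.norm_real, Real.norm_eq_abs,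
      Real.norm_of_nonneg hx0.le]
    gcongr
    · exact hx.2
    · exact hC _ (by positivity)
  · exact (intervalIntegrable_cormackKernel m hM).abs.mul_const _
  · refine Filter.Eventually.of_forall fun x _ r' _ => HasDerivAt.const_mul _ ?_
    have h1 := (hg (r' * x)).scomp r' ((hasDerivAt_id r').mul_const x)
    exact h1.congr_deriv (by simp)

lemma mul_kernelTransform (m : ℕ) (hg : ∀ s, HasDerivAt g (g' s) s)
    (hg' : Continuous g') (hg0 : ∀ s, 1 < s → g s = 0)
    (h0 : (cormackPrimitive m 0 : ℂ) * g 0 = 0) {r M : ℝ} (hr : 0 < r) (hM : 1 ≤ M)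
    (hrM : 1 < r * M) :
    m * kernelTransform m g r = r * ∫ x in (0 : ℝ)..M, (cormackPrimitive m x : ℂ) * g' (r * x) := by
  have hgc : Continuous g := continuous_iff_continuousAt.2 fun s => (hg s).continuousAt
  have hL := continuous_cormackPrimitive m
  have hi1 := intervalIntegrable_cormackKernel_mul m hM (by fun_prop : Continuous fun x => g (r * x))
  have hi2 : IntervalIntegrable (fun x => (cormackPrimitive m x : ℂ) * g' (r * x)) volume 0 M :=
    Continuous.intervalIntegrable (by fun_prop) _ _
  have h := MeasureTheory.integral_eq_of_hasDerivAt_off_countable_of_le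
    (fun x => (cormackPrimitive m x : ℂ) * g (r * x))
    (fun x => r * ((cormackPrimitive m x : ℂ) * g' (r * x)) -
      m * ((cormackKernel m x : ℂ) * g (r * x)))
    (zero_le_one.trans hM) (countable_singleton 1) (by fun_prop) ?_
    ((hi2.const_mul _).sub (hi1.const_mul _))
  · rw [intervalIntegral.integral_sub (hi2.const_mul _) (hi1.const_mul _),
      intervalIntegral.integral_const_mul, intervalIntegral.integral_const_mul, hg0 _ hrM,
      mul_zero r, h0, ← kernelTransform_eq_intervalIntegral m hg0 hr (by linarith) hrM.le] at h
    linear_combination -h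
  · intro x hx
    have h1 := (hasDerivAt_cormackPrimitive m (x := x) fun e => hx.2 e).ofReal_comp
    have h2 := (hg (r * x)).scomp x ((hasDerivAt_id x).const_mul r)
    refine (h1.mul h2).congr_deriv ?_
    simp
    ring

lemma hasDerivAt_pow_mul_kernelTransform (m : ℕ) (hg : ∀ s, HasDerivAt g (g' s) s)
    (hg' : Continuous g') (hg0 : ∀ s, 1 < s → g s = 0) (hg'0 : ∀ s, 1 < s → g' s = 0)
    {C : ℝ} (hC : ∀ s, 0 ≤ s → ‖g' s‖ ≤ C)
    (h0 : (cormackPrimitive (m + 1) 0 : ℂ) * g 0 = 0) {r : ℝ} (hr : 0 < r) :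
    HasDerivAt (fun r : ℝ => (r : ℂ) ^ (m + 1) * kernelTransform (m + 1) g r)
      ((r : ℂ) ^ (m + 1) * kernelTransform m g' r) r := by
  have hM : 1 ≤ 1 + 1 / r := by linarith [one_div_pos.2 hr]
  have hrM : 1 < r * (1 + 1 / r) := by
    rw [mul_add, mul_one_div_cancel hr.ne']
    linarith
  have h1 := (((hasDerivAt_id r).ofReal_comp.pow (m + 1)).mul
    (hasDerivAt_kernelTransform (m + 1) hg hg' hg0 hC hr hM hrM))
  have h2 := mul_kernelTransform (m + 1) hg hg' hg0 h0 hr hM hrM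
  have hL := continuous_cormackPrimitive (m + 1)
  have hi1 : IntervalIntegrable (fun x => (cormackKernel (m + 1) x : ℂ) * (x * g' (r * x)))
      volume 0 (1 + 1 / r) :=
    intervalIntegrable_cormackKernel_mul (m + 1) hM (by fun_prop)
  have hi2 : IntervalIntegrable (fun x => (cormackPrimitive (m + 1) x : ℂ) * g' (r * x))
      volume 0 (1 + 1 / r) := Continuous.intervalIntegrable (by fun_prop) _ _
  refine h1.congr_deriv ?_
  have h3 : kernelTransform m g' r =
      (∫ x in (0 : ℝ)..(1 + 1 / r), (cormackPrimitive (m + 1) x : ℂ) * g' (r * x)) +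
      ∫ x in (0 : ℝ)..(1 + 1 / r), (cormackKernel (m + 1) x : ℂ) * (x * g' (r * x)) := by
    rw [kernelTransform_eq_intervalIntegral m hg'0 hr (by linarith) hrM.le,
      ← intervalIntegral.integral_add hi2 hi1]
    congr 1 with x
    rw [← cormackPrimitive_add_mul_cormackKernel]
    push_cast
    ring
  rw [h3]
  push_cast at h2 ⊢
  simp only [id, Pi.pow_apply]
  linear_combination (r : ℂ) ^ m * h2

lemma norm_kernelTransform_le (m : ℕ) (hg : ∀ s, HasDerivAt g (g' s) s)
    (hg' : Continuous g') (hg0 : ∀ s, 1 < s → g s = 0) {C : ℝ}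
    (hC : ∀ s, 0 ≤ s → ‖g' s‖ ≤ C) (h0 : (cormackPrimitive (m + 1) 0 : ℂ) * g 0 = 0) {r : ℝ}
    (hr : 0 < r) : ‖kernelTransform (m + 1) g r‖ ≤ C * (r + 1) := by
  have hM : 1 ≤ 1 + 1 / r := by linarith [one_div_pos.2 hr]
  have hrM : 1 < r * (1 + 1 / r) := by
    rw [mul_add, mul_one_div_cancel hr.ne']
    linarith
  have h2 := congrArg norm (mul_kernelTransform (m + 1) hg hg' hg0 h0 hr hM hrM)
  have h3 : ‖∫ x in (0 : ℝ)..(1 + 1 / r), (cormackPrimitive (m + 1) x : ℂ) * g' (r * x)‖ ≤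
      C * |1 + 1 / r - 0| := by
    refine intervalIntegral.norm_integral_le_of_norm_le_const fun x hx => ?_
    rw [uIoc_of_le (by linarith)] at hx
    have hx0 := hx.1
    rw [norm_mul, Complex.norm_real, Real.norm_eq_abs]
    calc _ ≤ 1 * C := by
          gcongr
          · exact abs_cormackPrimitive_le_one _ hx0.le
          · exact hC _ (by positivity)
      _ = C := one_mul C
  rw [sub_zero, abs_of_nonneg (by linarith)] at h3
  rw [norm_mul, norm_mul, Complex.norm_real, Real.norm_of_nonneg hr.le, Complex.norm_natCast] at h2
  have h4 : ‖kernelTransform (m + 1) g r‖ ≤ (m + 1 : ℕ) * ‖kernelTransform (m + 1) g r‖ :=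
    le_mul_of_one_le_left (norm_nonneg _) (by push_cast; linarith [(Nat.cast_nonneg m : (0:ℝ) ≤ m)])
  calc _ ≤ r * (C * (1 + 1 / r)) := by
        rw [h2] at h4
        exact h4.trans (by gcongr)
    _ = C * (r + 1) := by field_simp

end KernelTransform

lemma IsAngular.cormackPrimitive_mul_xray_zero {m : ℕ} {F : ℝ × ℝ → ℂ} (hF : IsAngular m F) :
    (cormackPrimitive (m + 1) 0 : ℂ) * xray F 0 = 0 := by
  rcases Nat.even_or_odd m with hm | hm
  · have h : cormackPrimitive (m + 1) 0 = 0 := by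
      have : Odd ((m + 1 : ℕ) : ℤ) := by exact_mod_cast hm.add_one
      rw [cormackPrimitive, if_pos zero_le_one, Polynomial.Chebyshev.T_eval_zero_of_odd ℝ this]
    simp [h]
  · have h := hF.xray_neg 0
    have he : Complex.exp (Complex.I * (m : ℤ) * π) = -1 := by
      rw [show Complex.I * (m : ℤ) * π = (m : ℕ) * (π * Complex.I) by push_cast; ring,
        Complex.exp_nat_mul, Complex.exp_pi_mul_I, hm.neg_one_pow]
    rw [he, neg_zero] at h
    rw [show xray F 0 = 0 by linear_combination h / 2, mul_zero]

lemma SmoothOnDisk.exists_norm_xray_le {F : ℝ × ℝ → ℂ} (hF : SmoothOnDisk F) :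
    ∃ C, ∀ s, 0 ≤ s → ‖xray F s‖ ≤ C := by
  have hc : Continuous (xray F) := continuous_iff_continuousAt.2 fun s =>
    (hF.hasDerivAt_xray s).continuousAt
  obtain ⟨C, hC⟩ := (isCompact_Icc (a := (0 : ℝ)) (b := 1)).exists_bound_of_continuousOn
    hc.continuousOn
  refine ⟨C, fun s hs => ?_⟩
  rcases le_or_gt s 1 with h | h
  · exact hC s ⟨hs, h⟩
  · rw [hF.xray_eq_zero h, norm_zero]
    exact (norm_nonneg _).trans (hC 0 (by simp))

theorem IsAngular.eq_kernelTransform (m : ℕ) : ∀ {F : ℝ × ℝ → ℂ}, IsAngular m F → ∀ {r : ℝ},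
    0 < r → F (r, 0) = -(1 / π) * kernelTransform m (xray (lowering F)) r := by
  induction m with
  | zero => exact fun hF _ hr => IsAngular.eq_kernelTransform_zero (by simpa using hF) hr
  | succ m ih =>
    intro F hF r hr
    have hu : IsAngular m (lowering F) := by simpa using hF.lowering
    have hder : ∀ s, HasDerivAt (xray (lowering F)) (xray (lowering (lowering F)) s) s :=
      hu.hasDerivAt_xray_lowering
    have hcont : Continuous (xray (lowering (lowering F))) := continuous_iff_continuousAt.2 fun s =>
      (hu.lowering.hasDerivAt_xray s).continuousAt
    have hzero : ∀ s, 1 < s → xray (lowering F) s = 0 := fun s => hu.xray_eq_zero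
    obtain ⟨C, hC⟩ := hu.lowering.exists_norm_xray_le
    have h0 := hu.cormackPrimitive_mul_xray_zero
    set D : ℝ → ℂ := fun r => (r : ℂ) ^ (m + 1) * F (r, 0) +
      1 / π * ((r : ℂ) ^ (m + 1) * kernelTransform (m + 1) (xray (lowering F)) r) with hD
    have hD' : ∀ ρ ∈ Ioi (0 : ℝ), HasDerivAt D 0 ρ := by
      intro ρ hρ
      have h1 := ((hasDerivAt_id ρ).ofReal_comp.pow (m + 1)).mul (hF.hasDerivAt_axis ρ)
      have h2 := (hasDerivAt_pow_mul_kernelTransform m hder hcont hzero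
        (fun s => hu.lowering.xray_eq_zero) hC h0 hρ).const_mul (1 / π : ℂ)
      refine (h1.add h2).congr_deriv ?_
      have h3 := hF.mul_lowering_axis ρ
      have h4 := ih hu hρ
      simp only [id, Pi.pow_apply]
      push_cast at h3 ⊢
      linear_combination -(ρ : ℂ) ^ m * h3 + (ρ : ℂ) ^ (m + 1) * h4
    have hconst : ∀ ρ ∈ Ioi (0 : ℝ), D ρ = D r := fun ρ hρ =>
      isOpen_Ioi.is_const_of_deriv_eq_zero isPreconnected_Ioi
        (fun x hx => (hD' x hx).differentiableAt.differentiableWithinAt)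
        (fun x hx => (hD' x hx).deriv) hρ hr
    have hcF : Continuous fun ρ : ℝ => F (ρ, 0) := hF.contDiff.continuous.comp (by fun_prop)
    have hlim : Filter.Tendsto D (nhdsWithin 0 (Ioi 0)) (nhds 0) := by
      have hb : Filter.Tendsto (fun ρ : ℝ => ρ ^ (m + 1) * ‖F (ρ, 0)‖ +
          1 / π * (ρ ^ (m + 1) * (C * (ρ + 1)))) (nhdsWithin 0 (Ioi 0)) (nhds 0) := by
        refine Filter.Tendsto.mono_left ?_ nhdsWithin_le_nhds
        have : Continuous (fun ρ : ℝ => ρ ^ (m + 1) * ‖F (ρ, 0)‖ +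
          1 / π * (ρ ^ (m + 1) * (C * (ρ + 1)))) :=
          ((continuous_pow _).mul hcF.norm).add (by fun_prop)
        simpa using this.tendsto 0
      refine squeeze_zero_norm' ?_ hb
      filter_upwards [self_mem_nhdsWithin] with ρ hρ
      have hρ' := mem_Ioi.1 hρ
      refine (norm_add_le _ _).trans ?_
      simp only [norm_mul, norm_pow, Complex.norm_real, norm_div, norm_one,
        Real.norm_of_nonneg hρ'.le, Real.norm_of_nonneg Real.pi_pos.le]
      gcongr
      exact norm_kernelTransform_le m hder hcont hzero hC h0 hρ
    have hDr : D r = 0 := by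
      refine tendsto_nhds_unique (tendsto_const_nhds.congr' ?_) hlim
      filter_upwards [self_mem_nhdsWithin] with ρ hρ using (hconst ρ hρ).symm
    have hr' : (r : ℂ) ^ (m + 1) ≠ 0 := pow_ne_zero _ (Complex.ofReal_ne_zero.2 hr.ne')
    refine mul_left_cancel₀ hr' ?_
    linear_combination hDr

lemma IsAngular.reflect {n : ℤ} {F : ℝ × ℝ → ℂ} (hF : IsAngular n F) :
    IsAngular (-n) fun x => F (x.1, -x.2) where
  contDiff := hF.contDiff.comp (by fun_prop)
  eq_zero x hx := hF.eq_zero _ (by simpa using hx)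
  apply_rotate α x := by
    have h := hF.apply_rotate (-α) (x.1, -x.2)
    rw [rotate_apply] at h ⊢
    convert h using 2
    · simp
      ring_nf
    · push_cast
      ring_nf

/-- The inversion formula for functions with a single angular frequency. -/
theorem IsAngular.eq_kernelTransform_deriv {n : ℤ} {F : ℝ × ℝ → ℂ} (hF : IsAngular n F) {r : ℝ}
    (hr : 0 < r) : F (r, 0) = -(1 / π) * kernelTransform n.natAbs (deriv (xray F)) r := by
  have key : ∀ {m : ℕ} {H : ℝ × ℝ → ℂ}, IsAngular m H →
      H (r, 0) = -(1 / π) * kernelTransform m (deriv (xray H)) r := by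
    intro m H hH
    rw [show deriv (xray H) = xray (lowering H) from
      funext fun s => (hH.hasDerivAt_xray_lowering s).deriv]
    exact hH.eq_kernelTransform m hr
  rcases Int.natAbs_eq n with hn | hn
  · rw [hn] at hF
    exact key hF
  · have hR := hF.reflect
    rw [hn, neg_neg] at hR
    have h := key hR
    have hx : xray (fun x => F (x.1, -x.2)) = xray F := by
      ext s
      exact integral_neg_eq_self (fun t => F (s, t)) volume
    rw [hx, neg_zero] at h
    exact h

/-- The component of `h` of angular frequency `n`. -/
def angularPart (h : ℝ × ℝ → ℝ) (n : ℤ) (x : ℝ × ℝ) : ℂ :=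
  fourierCoeff' (fun φ => h (rotate φ x)) n

lemma contDiff_rotate : ContDiff ℝ (⊤ : ℕ∞) fun p : (ℝ × ℝ) × ℝ => rotate p.2 p.1 := by
  simp only [rotate_apply]
  fun_prop

lemma isAngular_angularPart {h : ℝ × ℝ → ℝ} (hsm : ContDiff ℝ (⊤ : ℕ∞) h)
    (hzero : ∀ x : ℝ × ℝ, 1 < x.1 ^ 2 + x.2 ^ 2 → h x = 0) (n : ℤ) :
    IsAngular n (angularPart h n) where
  contDiff := by
    refine contDiff_const.mul (contDiff_infty.2 fun k => ?_)
    refine contDiff_intervalIntegral 0 (2 * π) k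
      (φ := fun p => (h (rotate p.2 p.1) : ℂ) * Complex.exp (-Complex.I * n * p.2)) ?_
    refine (Complex.ofRealCLM.contDiff.comp (hsm.comp contDiff_rotate)).mul ?_
    exact (contDiff_const.mul (Complex.ofRealCLM.contDiff.comp contDiff_snd)).cexp
  eq_zero x hx := by
    have : ∀ φ, h (rotate φ x) = 0 := fun φ => hzero _ (by
      rw [rotate_apply]
      convert hx using 1
      linear_combination (x.1 ^ 2 + x.2 ^ 2) * Real.cos_sq_add_sin_sq φ)
    simp [angularPart, fourierCoeff', this]
  apply_rotate α x := by
    set k : ℝ → ℂ := fun φ => (h (rotate φ x) : ℂ) * Complex.exp (-Complex.I * n * φ) with hk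
    have hper : Function.Periodic k (2 * π) := by
      intro φ
      have he : Complex.exp (-Complex.I * n * (φ + 2 * π : ℝ)) =
          Complex.exp (-Complex.I * n * φ) := by
        rw [Complex.exp_eq_exp_iff_exists_int]
        exact ⟨-n, by push_cast; ring⟩
      simp only [hk, he, rotate_apply, Real.cos_add_two_pi, Real.sin_add_two_pi]
    have hshift : ∀ φ : ℝ, (h (rotate φ (rotate α x)) : ℂ) * Complex.exp (-Complex.I * n * φ) =
        Complex.exp (Complex.I * n * α) * k (φ + α) := by
      intro φ
      have h1 : rotate φ (rotate α x) = rotate (φ + α) x := by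
        simp only [rotate_apply, Real.cos_add, Real.sin_add]
        ext <;> simp only <;> ring
      rw [h1, hk]
      simp only
      rw [mul_left_comm, ← Complex.exp_add]
      congr 2
      push_cast
      ring
    have hk_shift : ∫ φ in (0 : ℝ)..(2 * π), k (φ + α) = ∫ φ in (0 : ℝ)..(2 * π), k φ := by
      rw [intervalIntegral.integral_comp_add_right, zero_add, add_comm (2 * π),
        hper.intervalIntegral_add_eq α 0, zero_add]
    simp only [angularPart, fourierCoeff', hshift, intervalIntegral.integral_const_mul]
    rw [hk_shift]
    simp only [hk]
    ring

lemma smul_Phi_add_smul_Phi (s t φ : ℝ) :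
    s • Phi φ + t • Phi (φ + π / 2) = rotate φ (s, t) := by
  rw [rotate_apply]
  ext
  · simp [Phi, Real.cos_add_pi_div_two]
    ring
  · simp [Phi, Real.sin_add_pi_div_two]
    ring

lemma angularPart_axis (h : ℝ × ℝ → ℝ) (n : ℤ) (r : ℝ) :
    angularPart h n (r, 0) = fourierCoeff' (fun φ => h (r • Phi φ)) n := by
  simp only [angularPart, ← smul_Phi_add_smul_Phi, zero_smul, add_zero]

lemma xray_angularPart {h : ℝ × ℝ → ℝ} (hsm : ContDiff ℝ (⊤ : ℕ∞) h)
    (hzero : ∀ x : ℝ × ℝ, 1 < x.1 ^ 2 + x.2 ^ 2 → h x = 0) (n : ℤ) (s : ℝ) :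
    xray (angularPart h n) s = fourierCoeff' (fun φ => radon h s φ) n := by
  have hradon : ∀ φ, (radon h s φ : ℂ) * Complex.exp (-Complex.I * n * φ) =
      ∫ t in (-2 : ℝ)..2, (h (rotate φ (s, t)) : ℂ) * Complex.exp (-Complex.I * n * φ) := by
    intro φ
    rw [intervalIntegral.integral_mul_const, intervalIntegral.integral_of_le (by norm_num),
      integral_complex_ofReal, radon]
    simp only [smul_Phi_add_smul_Phi]
    congr 2
    refine (setIntegral_eq_integral_of_forall_compl_eq_zero fun t ht => hzero _ ?_).symm
    have h1 : t ≤ -2 ∨ 2 < t := by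
      by_contra! h
      exact ht ⟨h.1, h.2⟩
    have h2 : 1 < s ^ 2 + t ^ 2 := by
      rcases h1 with h1 | h1 <;> nlinarith [sq_nonneg s]
    rw [rotate_apply]
    convert h2 using 1
    linear_combination (s ^ 2 + t ^ 2) * Real.cos_sq_add_sin_sq φ
  have hc : Continuous fun p : ℝ × ℝ =>
      (h (rotate p.2 (s, p.1)) : ℂ) * Complex.exp (-Complex.I * n * p.2) := by
    have hrot : Continuous fun p : ℝ × ℝ => rotate p.2 (s, p.1) := by
      simp only [rotate_apply]
      fun_prop
    exact (Complex.continuous_ofReal.comp (hsm.continuous.comp hrot)).mul (by fun_prop)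
  rw [(isAngular_angularPart hsm hzero n).xray_eq]
  simp only [angularPart, fourierCoeff', hradon, intervalIntegral.integral_const_mul]
  congr 1
  refine intervalIntegral_intervalIntegral_swap
    (F := fun t φ => (h (rotate φ (s, t)) : ℂ) * Complex.exp (-Complex.I * n * φ)) ?_
  exact (hc.continuousOn.integrableOn_compact (isCompact_uIcc.prod isCompact_uIcc)).mono_set
    (prod_mono uIoc_subset_uIcc uIoc_subset_uIcc)

/-- Perry's inversion formula for the Radon transform. -/
theorem perry_inversion (h : ℝ × ℝ → ℝ) (hsm : ContDiff ℝ (⊤ : ℕ∞) h)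
    (hsupp : Function.support h ⊆ unitDisk) (n : ℤ) (r : ℝ) (hr0 : 0 < r) (hr1 : r < 1) :
    fourierCoeff' (fun φ => h (r • Phi φ)) n =
      -(1 / ((π : ℂ) * (r : ℂ))) *
        ((∫ s in r..1,
            deriv (fun s' => fourierCoeff' (fun φ => radon h s' φ) n) s *
              (((s / r + Real.sqrt (s ^ 2 / r ^ 2 - 1)) ^ (-|n|) /
                  Real.sqrt (s ^ 2 / r ^ 2 - 1) : ℝ) : ℂ)) -
          ∫ s in (0 : ℝ)..r,
            deriv (fun s' => fourierCoeff' (fun φ => radon h s' φ) n) s *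
              (((Polynomial.Chebyshev.U ℝ (|n| - 1)).eval (s / r) : ℝ) : ℂ)) := by
  have hzero : ∀ x : ℝ × ℝ, 1 < x.1 ^ 2 + x.2 ^ 2 → h x = 0 := by
    intro x hx
    by_contra hne
    have hlt : x.1 ^ 2 + x.2 ^ 2 < 1 := hsupp hne
    linarith
  set A := angularPart h n with hA
  have hAng : IsAngular n A := isAngular_angularPart hsm hzero n
  have hG : (fun s => fourierCoeff' (fun φ => radon h s φ) n) = xray A :=
    funext fun s => (xray_angularPart hsm hzero n s).symm
  have hdG : deriv (xray A) = xray (lowering A) :=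
    funext fun s => (hAng.hasDerivAt_xray_lowering s).deriv
  have hcont : Continuous (deriv (xray A)) := hdG ▸ continuous_iff_continuousAt.2 fun s =>
    (hAng.lowering.hasDerivAt_xray s).continuousAt
  have hM : 1 ≤ 1 / r := (one_le_div hr0).2 hr1.le
  have hrM : r * (1 / r) = 1 := mul_one_div_cancel hr0.ne'
  have hr0' : (r : ℂ) ≠ 0 := Complex.ofReal_ne_zero.2 hr0.ne'
  set k : ℝ → ℂ := fun x => (cormackKernel n.natAbs x : ℂ) * deriv (xray A) (r * x) with hk
  have hki : ∀ {M : ℝ}, 1 ≤ M → IntervalIntegrable k volume 0 M := fun hM =>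
    intervalIntegrable_cormackKernel_mul n.natAbs hM (by fun_prop)
  have hsplit : kernelTransform n.natAbs (deriv (xray A)) r =
      (∫ x in (0 : ℝ)..1, k x) + ∫ x in (1 : ℝ)..(1 / r), k x := by
    rw [kernelTransform_eq_intervalIntegral n.natAbs
      (fun s hs => by rw [hdG, hAng.lowering.xray_eq_zero hs]) hr0 (zero_le_one.trans hM) hrM.ge]
    exact (intervalIntegral.integral_add_adjacent_intervals (hki le_rfl)
      ((hki le_rfl).symm.trans (hki hM))).symm
  rw [hG, ← angularPart_axis, ← hA, hAng.eq_kernelTransform_deriv hr0, hsplit]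
  have houter : ∫ x in (1 : ℝ)..(1 / r), k x = (r : ℂ)⁻¹ * ∫ s in r..1, deriv (xray A) s *
      (((s / r + Real.sqrt (s ^ 2 / r ^ 2 - 1)) ^ (-|n|) /
        Real.sqrt (s ^ 2 / r ^ 2 - 1) : ℝ) : ℂ) := by
    have hsub := intervalIntegral.integral_comp_mul_left (a := 1) (b := 1 / r)
      (fun s => deriv (xray A) s * (((s / r + Real.sqrt (s ^ 2 / r ^ 2 - 1)) ^ (-|n|) /
        Real.sqrt (s ^ 2 / r ^ 2 - 1) : ℝ) : ℂ)) hr0.ne'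
    rw [mul_one, hrM, Complex.real_smul, Complex.ofReal_inv] at hsub
    rw [← hsub]
    refine intervalIntegral.integral_congr_ae (Filter.Eventually.of_forall fun x hx => ?_)
    rw [uIoc_of_le hM] at hx
    have h1 : r * x / r = x := mul_div_cancel_left₀ x hr0.ne'
    have h2 : (r * x) ^ 2 / r ^ 2 = x ^ 2 := by rw [← div_pow, h1]
    have h3 : (x + √(x ^ 2 - 1)) ^ (-|n|) = (x - √(x ^ 2 - 1)) ^ n.natAbs := by
      rw [eq_inv_of_mul_eq_one_left (sub_sqrt_mul_add_sqrt hx.1), inv_pow, zpow_neg,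
        ← Int.natCast_natAbs, zpow_natCast]
    simp only [hk, cormackKernel, not_le.2 hx.1, if_false, h1, h2, h3]
    ring
  have hinner : ∫ x in (0 : ℝ)..1, k x = -((r : ℂ)⁻¹ * ∫ s in (0 : ℝ)..r, deriv (xray A) s *
      (((Polynomial.Chebyshev.U ℝ (|n| - 1)).eval (s / r) : ℝ) : ℂ)) := by
    have hsub := intervalIntegral.integral_comp_mul_left (a := 0) (b := 1)
      (fun s => deriv (xray A) s *
        (((Polynomial.Chebyshev.U ℝ (|n| - 1)).eval (s / r) : ℝ) : ℂ)) hr0.ne'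
    rw [mul_one, mul_zero, Complex.real_smul, Complex.ofReal_inv] at hsub
    rw [← hsub, ← intervalIntegral.integral_neg]
    refine intervalIntegral.integral_congr_ae (Filter.Eventually.of_forall fun x hx => ?_)
    rw [uIoc_of_le zero_le_one] at hx
    have h1 : r * x / r = x := mul_div_cancel_left₀ x hr0.ne'
    simp only [hk, cormackKernel, hx.2, if_true, h1, Int.natCast_natAbs]
    push_cast
    ring
  rw [houter, hinner]
  have hpi := Complex.ofReal_ne_zero.2 Real.pi_ne_zero
  field_simp
  ring
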